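/- arXiv:2502.10605 — 2 statements merged into one kernel-verified Lean document; each statement's English description precedes it below -/
import Mathlib

section
/- Fix a treatment level z. Let ν be a probability measure on a measurable space 𝒳, and let σ²(z,·), e(z,·), ẽ_h(z,·) : 𝒳 → ℝ be measurable with σ²(z,·) ≥ 0 and e(z,·), ẽ_h(z,·) > 0 ν-a.e. Assume S := ∫ √(σ²(z,·)·ẽ_h(z,·)/e(z,·)) dν satisfies 0 < S < ∞, and fix B > 0. Define π*(x) := (B/S)·√(σ²(z,x)) / √(e(z,x)·ẽ_h(z,x)); equivalently π*(x) is proportional to (√(σ²(z,x))/e(z,x))·√(e(z,x)/ẽ_h(z,x)). Then ∫ π*·ẽ_h(z,·) dν = B, and for every measurable π : 𝒳 → ℝ with π > 0 ν-a.e. and ∫ π·ẽ_h(z,·) dν ≤ B, one has ∫ σ²(z,·)/(e(z,·)·π) dν ≥ ∫ σ²(z,·)/(e(z,·)·π*) dν = S²/B. -/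
open MeasureTheory

/-- The optimal density times its cost is proportional to `√(s * t / e)`. -/
lemma sqrt_div_sqrt_mul_self {s e t : ℝ} (hs : 0 ≤ s) (he : 0 < e) (ht : 0 < t) (c : ℝ) :
    c * √s / √(e * t) * t = c * √(s * t / e) := by
  have hb : 0 < √t := Real.sqrt_pos.2 ht
  have ha : 0 < √e := Real.sqrt_pos.2 he
  rw [Real.sqrt_mul he.le, Real.sqrt_div (mul_nonneg hs ht.le), Real.sqrt_mul hs]
  nth_rewrite 2 [← Real.mul_self_sqrt ht.le]
  field_simp

/-- The optimal variance density is proportional to `√(s * t / e)`. -/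
lemma div_mul_sqrt_div_sqrt {s e t : ℝ} (hs : 0 ≤ s) (he : 0 < e) (ht : 0 < t) (c : ℝ) :
    s / (e * (c * √s / √(e * t))) = c⁻¹ * √(s * t / e) := by
  have ha : 0 < √e := Real.sqrt_pos.2 he
  rw [Real.sqrt_mul he.le, Real.sqrt_div (mul_nonneg hs ht.le), Real.sqrt_mul hs]
  rcases eq_or_ne c 0 with rfl | hc
  · simp
  rcases hs.eq_or_lt with rfl | hs'
  · simp
  have hr : 0 < √s := Real.sqrt_pos.2 hs'
  nth_rewrite 1 [← Real.mul_self_sqrt hs]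
  nth_rewrite 1 [← Real.mul_self_sqrt he.le]
  field_simp

/-- Weighted AM-GM inequality between the variance density and the cost density. -/
lemma two_mul_sqrt_le_div_add {s e t p : ℝ} (hs : 0 ≤ s) (he : 0 < e) (ht : 0 < t)
    (hp : 0 < p) (k : ℝ) :
    2 * k * √(s * t / e) ≤ s / (e * p) + k ^ 2 * (p * t) := by
  have hsplit : √(s * t / e) = √(s / (e * p)) * √(p * t) := by
    rw [← Real.sqrt_mul (by positivity)]
    congr 1
    field_simp
  have hu : √(s / (e * p)) ^ 2 = s / (e * p) := Real.sq_sqrt (by positivity)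
  have hv : √(p * t) ^ 2 = p * t := Real.sq_sqrt (by positivity)
  have hsq := sq_nonneg (√(s / (e * p)) - k * √(p * t))
  rw [sub_sq, mul_pow, hu, hv] at hsq
  rw [hsplit]
  linarith

/-- Optimal annotation probabilities for continuous treatments (fixed treatment
level `z`): with `s = σ²(z,·)`, `e = e(z,·)` the generalized propensity score and
`etil = ẽ_h(z,·)` its kernel localization, `π* = (B/S)·√s/√(e·etil)` with
`S = ∫ √(s·etil/e) dν` exhausts the budget `∫ π·etil dν ≤ B` and minimizes
`∫ s/(e·π) dν`, with optimal value `S²/B`. -/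
theorem optimal_sampling_continuous_treatment
    {𝒳 : Type*} [MeasurableSpace 𝒳] (ν : Measure 𝒳) [IsProbabilityMeasure ν]
    (s e etil : 𝒳 → ℝ)
    (hsm : Measurable s) (hem : Measurable e) (hetilm : Measurable etil)
    (hs : ∀ᵐ x ∂ν, 0 ≤ s x) (he : ∀ᵐ x ∂ν, 0 < e x) (hetil : ∀ᵐ x ∂ν, 0 < etil x)
    (hfin : Integrable (fun x => Real.sqrt (s x * etil x / e x)) ν)
    (S : ℝ) (hS : S = ∫ x, Real.sqrt (s x * etil x / e x) ∂ν) (hSpos : 0 < S)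
    (B : ℝ) (hB : 0 < B)
    (πstar : 𝒳 → ℝ)
    (hπstar : πstar = fun x => (B / S) * Real.sqrt (s x) / Real.sqrt (e x * etil x)) :
    (∫⁻ x, ENNReal.ofReal (πstar x * etil x) ∂ν = ENNReal.ofReal B) ∧
    (∫⁻ x, ENNReal.ofReal (s x / (e x * πstar x)) ∂ν = ENNReal.ofReal (S ^ 2 / B)) ∧
    (∀ π : 𝒳 → ℝ, Measurable π → (∀ᵐ x ∂ν, 0 < π x) →
      ∫⁻ x, ENNReal.ofReal (π x * etil x) ∂ν ≤ ENNReal.ofReal B →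
      ∫⁻ x, ENNReal.ofReal (s x / (e x * πstar x)) ∂ν ≤
        ∫⁻ x, ENNReal.ofReal (s x / (e x * π x)) ∂ν) := by
  have hlin : ∀ c : ℝ, 0 ≤ c →
      ∫⁻ x, ENNReal.ofReal (c * √(s x * etil x / e x)) ∂ν = ENNReal.ofReal (c * S) := by
    intro c hc
    rw [← ofReal_integral_eq_lintegral_ofReal (hfin.const_mul c)
      (.of_forall fun x => mul_nonneg hc (Real.sqrt_nonneg _)), integral_const_mul, ← hS]
  have hvalue : ∫⁻ x, ENNReal.ofReal (s x / (e x * πstar x)) ∂ν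
      = ENNReal.ofReal (S ^ 2 / B) := by
    have hcongr : ∀ᵐ x ∂ν, ENNReal.ofReal (s x / (e x * πstar x))
        = ENNReal.ofReal ((B / S)⁻¹ * √(s x * etil x / e x)) := by
      filter_upwards [hs, he, hetil] with x h₁ h₂ h₃
      rw [hπstar, div_mul_sqrt_div_sqrt h₁ h₂ h₃]
    rw [lintegral_congr_ae hcongr, hlin _ (by positivity)]
    congr 1
    field_simp
  refine ⟨?_, hvalue, fun π hπm hπ hbudget => ?_⟩
  · have hcongr : ∀ᵐ x ∂ν, ENNReal.ofReal (πstar x * etil x)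
        = ENNReal.ofReal (B / S * √(s x * etil x / e x)) := by
      filter_upwards [hs, he, hetil] with x h₁ h₂ h₃
      rw [hπstar, sqrt_div_sqrt_mul_self h₁ h₂ h₃]
    rw [lintegral_congr_ae hcongr, hlin _ (by positivity)]
    congr 1
    field_simp
  · rw [hvalue]
    refine ENNReal.le_of_add_le_add_right (ENNReal.ofReal_ne_top (r := S ^ 2 / B)) ?_
    calc ENNReal.ofReal (S ^ 2 / B) + ENNReal.ofReal (S ^ 2 / B)
        = ∫⁻ x, ENNReal.ofReal (2 * (S / B) * √(s x * etil x / e x)) ∂ν := by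
          rw [hlin _ (by positivity), ← ENNReal.ofReal_add (by positivity) (by positivity)]
          congr 1
          ring
      _ ≤ ∫⁻ x, (ENNReal.ofReal (s x / (e x * π x))
            + ENNReal.ofReal ((S / B) ^ 2) * ENNReal.ofReal (π x * etil x)) ∂ν := by
          refine lintegral_mono_ae ?_
          filter_upwards [hs, he, hetil, hπ] with x h₁ h₂ h₃ h₄
          rw [← ENNReal.ofReal_mul (by positivity),
            ← ENNReal.ofReal_add (by positivity) (by positivity)]
          exact ENNReal.ofReal_le_ofReal (two_mul_sqrt_le_div_add h₁ h₂ h₃ h₄ _)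
      _ = ∫⁻ x, ENNReal.ofReal (s x / (e x * π x)) ∂ν
            + ENNReal.ofReal ((S / B) ^ 2) * ∫⁻ x, ENNReal.ofReal (π x * etil x) ∂ν := by
          rw [lintegral_add_left (by fun_prop), lintegral_const_mul _ (by fun_prop)]
      _ ≤ ∫⁻ x, ENNReal.ofReal (s x / (e x * π x)) ∂ν
            + ENNReal.ofReal ((S / B) ^ 2) * ENNReal.ofReal B := by gcongr
      _ = ∫⁻ x, ENNReal.ofReal (s x / (e x * π x)) ∂ν + ENNReal.ofReal (S ^ 2 / B) := by
          rw [← ENNReal.ofReal_mul (by positivity)]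
          congr 2
          field_simp
end

section
/- Let μ be a probability measure on a measurable space 𝒳, let σ₁², σ₀² : 𝒳 → ℝ be measurable, nonnegative and μ-integrable with σ_z²/e_z μ-integrable, let e₁ : 𝒳 → (0,1) be measurable with e₀ := 1 − e₁, and let V ≥ 0 be a real number. Set N := (∫ (√σ₁² + √σ₀²) dμ)² and D := ∫ (σ₁²/e₁ + σ₀²/e₀) dμ, and assume D > 0. Define RelEff(B) := (N/B + V)/(D/B + V) for B > 0. Then RelEff(B) ≤ 1 for all B > 0, and RelEff is nondecreasing in B: for all 0 < B ≤ B′, RelEff(B) ≤ RelEff(B′). -/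
open MeasureTheory

/-- Weighted Cauchy–Schwarz (Titu) inequality for square roots. -/
lemma sq_sqrt_add_sqrt_le_div_add_div {a b e : ℝ} (ha : 0 ≤ a) (hb : 0 ≤ b)
    (he : e ∈ Set.Ioo (0 : ℝ) 1) :
    (√a + √b) ^ 2 ≤ a / e + b / (1 - e) := by
  have he0 : 0 < e := he.1
  have he1 : 0 < 1 - e := sub_pos.2 he.2
  rw [div_add_div _ _ he0.ne' he1.ne', le_div_iff₀ (mul_pos he0 he1)]
  nlinarith [sq_nonneg (√a * (1 - e) - √b * e), Real.sq_sqrt ha, Real.sq_sqrt hb]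

/-- Jensen's inequality for the square, with an integrable upper bound of the square. -/
lemma sq_integral_le_integral_of_sq_le {𝒳 : Type*} [MeasurableSpace 𝒳] {μ : Measure 𝒳}
    [IsProbabilityMeasure μ] {f g : 𝒳 → ℝ} (hf : AEStronglyMeasurable f μ)
    (hg : Integrable g μ) (hfg : ∀ x, f x ^ 2 ≤ g x) :
    (∫ x, f x ∂μ) ^ 2 ≤ ∫ x, g x ∂μ := by
  have hf2 : Integrable (fun x => f x ^ 2) μ :=
    hg.mono' (hf.pow 2) (.of_forall fun x => by
      rw [Real.norm_of_nonneg (sq_nonneg _)]; exact hfg x)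
  have hvar := ProbabilityTheory.variance_nonneg f μ
  rw [ProbabilityTheory.variance_eq_sub ((memLp_two_iff_integrable_sq hf).2 hf2)] at hvar
  exact (sub_nonneg.1 hvar).trans (integral_mono hf2 hg hfg)

/-- Relative efficiency of optimized versus uniform annotation:
`RelEff(B) = (N/B + V)/(D/B + V)` with `N = (∫(√σ₁²+√σ₀²)dμ)²` and
`D = ∫(σ₁²/e₁+σ₀²/e₀)dμ` satisfies `RelEff(B) ≤ 1` and is nondecreasing in
the budget `B`. -/
theorem relative_efficiency
    {𝒳 : Type*} [MeasurableSpace 𝒳] (μ : Measure 𝒳) [IsProbabilityMeasure μ]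
    (s1 s0 e1 : 𝒳 → ℝ)
    (hs1m : Measurable s1) (hs0m : Measurable s0)
    (hs1 : ∀ x, 0 ≤ s1 x) (hs0 : ∀ x, 0 ≤ s0 x)
    (hs1i : Integrable s1 μ) (hs0i : Integrable s0 μ)
    (he1m : Measurable e1) (he1 : ∀ x, e1 x ∈ Set.Ioo (0 : ℝ) 1)
    (hs1e : Integrable (fun x => s1 x / e1 x) μ)
    (hs0e : Integrable (fun x => s0 x / (1 - e1 x)) μ)
    (V : ℝ) (hV : 0 ≤ V)
    (N D : ℝ)
    (hN : N = (∫ x, (Real.sqrt (s1 x) + Real.sqrt (s0 x)) ∂μ) ^ 2)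
    (hD : D = ∫ x, (s1 x / e1 x + s0 x / (1 - e1 x)) ∂μ)
    (hDpos : 0 < D)
    (RelEff : ℝ → ℝ)
    (hRE : ∀ B, RelEff B = (N / B + V) / (D / B + V)) :
    (∀ B, 0 < B → RelEff B ≤ 1) ∧
    (∀ B B', 0 < B → B ≤ B' → RelEff B ≤ RelEff B') := by
  have hND : N ≤ D := by
    rw [hN, hD]
    exact sq_integral_le_integral_of_sq_le
      (hs1m.sqrt.add hs0m.sqrt).aestronglyMeasurable (hs1e.add hs0e)
      fun x => sq_sqrt_add_sqrt_le_div_add_div (hs1 x) (hs0 x) (he1 x)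
  have hform : ∀ B, 0 < B → RelEff B = (N + V * B) / (D + V * B) := fun B hB => by
    rw [hRE, div_add' _ _ _ hB.ne', div_add' _ _ _ hB.ne', div_div_div_cancel_right₀ hB.ne']
  have hden : ∀ B, 0 < B → 0 < D + V * B := fun B hB =>
    add_pos_of_pos_of_nonneg hDpos (mul_nonneg hV hB.le)
  refine ⟨fun B hB => ?_, fun B B' hB hBB' => ?_⟩
  · rw [hform B hB, div_le_one (hden B hB)]
    gcongr
  · have hB' := hB.trans_le hBB'
    rw [hform B hB, hform B' hB', div_le_div_iff₀ (hden B hB) (hden B' hB')]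
    nlinarith [mul_nonneg (mul_nonneg hV (sub_nonneg.2 hBB')) (sub_nonneg.2 hND)]
end
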